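/- Let k be a field of characteristic not 2 in which -1 is not a square, let K be a field extension of k containing an element i with i² = -1, and let n ≥ 1. Suppose A ∈ Sp(2n,K) satisfies A² = -I and every entry of A is a k-multiple of i (i.e. A_{r,s} = c_{r,s}·i with c_{r,s} in the image of k). Then there exists an invertible 2n×2n matrix X over k such that, viewing X over K, A = X·[[i·Iₙ, 0],[0, -i·Iₙ]]·X⁻¹ and XᵀJX = [[0, X₁],[-X₁, 0]] for some diagonal n×n matrix X₁ over k. -/

import Mathlib

open Matrix

/-- The standard symplectic form matrix `J = [[0, Iₙ], [-Iₙ, 0]]`. -/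
def SpJ (n : ℕ) (R : Type*) [CommRing R] : Matrix (Fin n ⊕ Fin n) (Fin n ⊕ Fin n) R :=
  Matrix.fromBlocks 0 1 (-1) 0

/-- `M` belongs to the symplectic group `Sp(2n,R)`, i.e. `Mᵀ J M = J`. -/
def IsSymp {n : ℕ} {R : Type*} [CommRing R]
    (M : Matrix (Fin n ⊕ Fin n) (Fin n ⊕ Fin n) R) : Prop :=
  Mᵀ * SpJ n R * M = SpJ n R

theorem SpJ_mul_self (n : ℕ) (R : Type*) [CommRing R] : SpJ n R * SpJ n R = -1 := by
  rw [SpJ, fromBlocks_multiply, ← fromBlocks_one, fromBlocks_neg]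
  simp

theorem SpJ_transpose (n : ℕ) (R : Type*) [CommRing R] : (SpJ n R)ᵀ = -SpJ n R := by
  simp [SpJ, fromBlocks_transpose, fromBlocks_neg]

theorem isUnit_SpJ (n : ℕ) (R : Type*) [CommRing R] : IsUnit (SpJ n R) :=
  IsUnit.of_mul_eq_one (-SpJ n R) (by rw [mul_neg, SpJ_mul_self, neg_neg])

theorem SpJ_map (n : ℕ) {R S : Type*} [CommRing R] [CommRing S] (f : R →+* S) :
    (SpJ n R).map f = SpJ n S := by
  rw [SpJ, fromBlocks_map, Matrix.map_neg f (map_neg f)]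
  simp [SpJ]

/-- The `1` and `-1` eigenspaces of an involution are complementary away from characteristic two. -/
theorem isCompl_ker_one_sub_ker_one_add {k V : Type*} [Field k] [AddCommGroup V] [Module k V]
    (hchar : (2 : k) ≠ 0) (f : V →ₗ[k] V) (hf : ∀ v, f (f v) = v) :
    IsCompl (LinearMap.ker (LinearMap.id - f)) (LinearMap.ker (LinearMap.id + f)) := by
  constructor
  · rw [Submodule.disjoint_def]
    intro v h₁ h₂
    simp only [LinearMap.mem_ker, LinearMap.sub_apply, LinearMap.add_apply,
      LinearMap.id_apply] at h₁ h₂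
    have h : (2 : k) • v = 0 := by
      rw [two_smul]
      calc v + v = (v - f v) + (v + f v) := by abel
        _ = 0 := by rw [h₁, h₂, add_zero]
    exact (smul_eq_zero.mp h).resolve_left hchar
  · rw [codisjoint_iff, eq_top_iff]
    intro v _
    have h₁ : (2 : k)⁻¹ • (v + f v) ∈ LinearMap.ker (LinearMap.id - f) := by
      simp only [LinearMap.mem_ker, LinearMap.sub_apply, LinearMap.id_apply, map_smul, map_add, hf]
      rw [sub_add_sub_cancel, sub_self, smul_zero]
    have h₂ : (2 : k)⁻¹ • (v - f v) ∈ LinearMap.ker (LinearMap.id + f) := by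
      simp only [LinearMap.mem_ker, LinearMap.add_apply, LinearMap.id_apply, map_smul, map_sub, hf]
      rw [add_comm (f v), sub_self, smul_zero]
    refine Submodule.mem_sup.mpr ⟨_, h₁, _, h₂, ?_⟩
    rw [← smul_add, add_add_sub_cancel, ← two_smul k v, smul_smul, inv_mul_cancel₀ hchar, one_smul]

/-- An involution which is skew for the symplectic form is conjugate to `diag(I, -I)`. -/
theorem exists_diagonalizing_of_skew_involution {k : Type*} [Field k] (hchar : (2 : k) ≠ 0) {n : ℕ}
    (C : Matrix (Fin n ⊕ Fin n) (Fin n ⊕ Fin n) k) (hC : C * C = 1)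
    (hJ : SpJ n k * C = -(Cᵀ * SpJ n k)) :
    ∃ X : Matrix (Fin n ⊕ Fin n) (Fin n ⊕ Fin n) k, IsUnit X ∧
      C * X = X * fromBlocks 1 0 0 (-1) := by
  have hdet : IsUnit (SpJ n k).det := (Matrix.isUnit_iff_isUnit_det _).mp (isUnit_SpJ n k)
  have hrank : (1 + C).rank = (1 - C).rank := by
    have h : SpJ n k * (1 + C) = (1 - C)ᵀ * SpJ n k := by
      rw [mul_add, hJ, transpose_sub, transpose_one, sub_mul, mul_one, one_mul, sub_eq_add_neg]
    rw [← rank_mul_eq_right_of_isUnit_det _ (1 + C) hdet, h,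
      rank_mul_eq_left_of_isUnit_det _ _ hdet, rank_transpose]
  have hf : ∀ v, C.mulVecLin (C.mulVecLin v) = v := by
    intro v
    simp [hC]
  have hcompl := isCompl_ker_one_sub_ker_one_add hchar C.mulVecLin hf
  have hp : (1 + C).mulVecLin = LinearMap.id + C.mulVecLin := by
    rw [Matrix.mulVecLin_add, Matrix.mulVecLin_one]
  have hm : (1 - C).mulVecLin = LinearMap.id - C.mulVecLin := by
    ext v
    simp
  have hr₁ := LinearMap.finrank_range_add_finrank_ker (LinearMap.id - C.mulVecLin)
  have hr₂ := LinearMap.finrank_range_add_finrank_ker (LinearMap.id + C.mulVecLin)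
  have hsum := Submodule.finrank_add_eq_of_isCompl hcompl
  rw [Matrix.rank, Matrix.rank, hp, hm] at hrank
  simp only [Module.finrank_fintype_fun_eq_card, Fintype.card_sum, Fintype.card_fin]
    at hr₁ hr₂ hsum
  let b₁ := Module.finBasisOfFinrankEq k (LinearMap.ker (LinearMap.id - C.mulVecLin))
    (n := n) (by omega)
  let b₂ := Module.finBasisOfFinrankEq k (LinearMap.ker (LinearMap.id + C.mulVecLin))
    (n := n) (by omega)
  let b := (b₁.prod b₂).map (Submodule.prodEquivOfIsCompl _ _ hcompl)
  have hl : ∀ j, C *ᵥ b (Sum.inl j) = b (Sum.inl j) := by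
    intro j
    have h := (b₁ j).2
    rw [LinearMap.mem_ker, LinearMap.sub_apply, sub_eq_zero] at h
    simpa [b] using h.symm
  have hr : ∀ j, C *ᵥ b (Sum.inr j) = -b (Sum.inr j) := by
    intro j
    have h := (b₂ j).2
    rw [LinearMap.mem_ker, LinearMap.add_apply, add_comm, add_eq_zero_iff_eq_neg] at h
    simpa [b] using h
  refine ⟨(Matrix.of b)ᵀ, ?_, ?_⟩
  · rw [Matrix.isUnit_transpose]
    exact Matrix.linearIndependent_rows_iff_isUnit.mp b.linearIndependent
  · have hD : (fromBlocks 1 0 0 (-1) : Matrix (Fin n ⊕ Fin n) (Fin n ⊕ Fin n) k) =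
        diagonal (Sum.elim 1 (-1)) := by
      rw [← fromBlocks_diagonal]
      congr 1
      ext a b
      by_cases h : a = b <;> simp [h]
    ext r (j | j)
    · rw [hD, mul_diagonal]
      simpa [Matrix.mulVec, Matrix.mul_apply, dotProduct] using congrFun (hl j) r
    · rw [hD, mul_diagonal]
      simpa [Matrix.mulVec, Matrix.mul_apply, dotProduct] using congrFun (hr j) r

/-- An involution which is skew for the symplectic form is diagonalized by a symplectic matrix. -/
theorem exists_isSymp_diagonalizing {k : Type*} [Field k] (hchar : (2 : k) ≠ 0) {n : ℕ}
    (C : Matrix (Fin n ⊕ Fin n) (Fin n ⊕ Fin n) k) (hC : C * C = 1)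
    (hJ : SpJ n k * C = -(Cᵀ * SpJ n k)) :
    ∃ X : Matrix (Fin n ⊕ Fin n) (Fin n ⊕ Fin n) k, IsUnit X ∧ IsSymp X ∧
      C * X = X * fromBlocks 1 0 0 (-1) := by
  obtain ⟨X, hX, hCX⟩ := exists_diagonalizing_of_skew_involution hchar C hC hJ
  obtain ⟨N, hN⟩ : ∃ N, N = Xᵀ * SpJ n k * X := ⟨_, rfl⟩
  have hNunit : IsUnit N := by
    rw [hN]
    exact (((Matrix.isUnit_transpose X).mpr hX).mul (isUnit_SpJ n k)).mul hX
  have hNskew : Nᵀ = -N := by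
    simp [hN, transpose_mul, SpJ_transpose, mul_assoc]
  have hND : N * fromBlocks 1 0 0 (-1) = -(fromBlocks 1 0 0 (-1) * N) := by
    have h := congrArg transpose hCX
    rw [transpose_mul, transpose_mul, fromBlocks_transpose] at h
    simp only [transpose_one, transpose_zero, transpose_neg] at h
    calc N * fromBlocks 1 0 0 (-1) = Xᵀ * (SpJ n k * C) * X := by
          rw [hN, mul_assoc, ← hCX]; simp only [mul_assoc]
      _ = -((Xᵀ * Cᵀ) * SpJ n k * X) := by rw [hJ]; simp only [mul_assoc, mul_neg, neg_mul]
      _ = _ := by rw [h, hN]; simp only [mul_assoc]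
  obtain ⟨P, Q, R, S, rfl⟩ : ∃ P Q R S, N = fromBlocks P Q R S :=
    ⟨_, _, _, _, (fromBlocks_toBlocks N).symm⟩
  rw [fromBlocks_multiply, fromBlocks_multiply, fromBlocks_neg, fromBlocks_inj] at hND
  rw [fromBlocks_transpose, fromBlocks_neg, fromBlocks_inj] at hNskew
  have half : ∀ T : Matrix (Fin n) (Fin n) k, T = -T → T = 0 := by
    intro T hT
    have h : (2 : k) • T = 0 := by rw [two_smul]; exact add_eq_zero_iff_eq_neg.mpr hT
    exact (smul_eq_zero.mp h).resolve_left hchar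
  obtain rfl : P = 0 := half P (by simpa using hND.1)
  obtain rfl : S = 0 := half S (by
    have h := hND.2.2.2
    simp only [mul_zero, zero_mul, zero_add, mul_neg, neg_mul, mul_one, one_mul, neg_neg] at h
    exact h.symm)
  obtain rfl : R = -Qᵀ := by rw [hNskew.2.2.1, neg_neg]
  have hQ : IsUnit Q := by
    obtain ⟨V, hV⟩ := hNunit.exists_right_inv
    rw [← fromBlocks_toBlocks V, fromBlocks_multiply, ← fromBlocks_one, fromBlocks_inj] at hV
    exact IsUnit.of_mul_eq_one _ (by simpa using hV.1)
  have hQdet : IsUnit Q.det := (Matrix.isUnit_iff_isUnit_det _).mp hQ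
  have hY : (fromBlocks 1 0 0 Q : Matrix (Fin n ⊕ Fin n) (Fin n ⊕ Fin n) k) *
      fromBlocks 1 0 0 Q⁻¹ = 1 := by
    rw [fromBlocks_multiply, ← fromBlocks_one]
    simp [Matrix.mul_nonsing_inv Q hQdet]
  refine ⟨X * fromBlocks 1 0 0 Q⁻¹, hX.mul (IsUnit.of_mul_eq_one_right _ hY), ?_, ?_⟩
  · have h : (Q⁻¹)ᵀ * Qᵀ = 1 := by
      rw [← transpose_mul, Matrix.mul_nonsing_inv Q hQdet, transpose_one]
    calc (X * fromBlocks 1 0 0 Q⁻¹)ᵀ * SpJ n k * (X * fromBlocks 1 0 0 Q⁻¹)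
        = (fromBlocks 1 0 0 Q⁻¹)ᵀ * (Xᵀ * SpJ n k * X) * fromBlocks 1 0 0 Q⁻¹ := by
          rw [transpose_mul]; simp only [mul_assoc]
      _ = SpJ n k := by
          rw [← hN, fromBlocks_transpose, fromBlocks_multiply, fromBlocks_multiply, SpJ]
          simp [Matrix.mul_nonsing_inv Q hQdet, h]
  · rw [← mul_assoc, hCX, mul_assoc, mul_assoc, fromBlocks_multiply, fromBlocks_multiply]
    simp

/-- Characterization of Type 4 involutions when `√(-α) ∈ k` (here `α = -1`, `s = i`):
a symplectic `A` over `K ⊇ k` with `A² = -I` whose entries are `k`-multiples of `i` is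
conjugate over `k` to `[[i·Iₙ,0],[0,-i·Iₙ]]`, with `XᵀJX = [[0,X₁],[-X₁,0]]`, `X₁` diagonal
over `k`. -/
theorem stmt17 {k K : Type*} [Field k] [Field K] [Algebra k K]
    (hchar : (2 : k) ≠ 0) (hsq : ∀ x : k, x ^ 2 ≠ -1)
    (i : K) (hi : i ^ 2 = -1) {n : ℕ} (hn : 1 ≤ n)
    (A : Matrix (Fin n ⊕ Fin n) (Fin n ⊕ Fin n) K) (hA : IsSymp A)
    (h2 : A * A = -1)
    (hent : ∀ r s, ∃ c : k, A r s = algebraMap k K c * i) :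
    ∃ X : Matrix (Fin n ⊕ Fin n) (Fin n ⊕ Fin n) k, IsUnit X ∧
      A = X.map (algebraMap k K) *
            Matrix.fromBlocks (i • (1 : Matrix (Fin n) (Fin n) K)) 0 0
              (-i • (1 : Matrix (Fin n) (Fin n) K)) *
          (X.map (algebraMap k K))⁻¹ ∧
      ∃ d : Fin n → k,
        Xᵀ * SpJ n k * X =
          Matrix.fromBlocks 0 (Matrix.diagonal d) (-(Matrix.diagonal d)) 0 := by
  choose c hc using hent
  obtain ⟨C, hCdef⟩ : ∃ C : Matrix (Fin n ⊕ Fin n) (Fin n ⊕ Fin n) k, C = Matrix.of c := ⟨_, rfl⟩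
  have hAC : A = i • C.map (algebraMap k K) := by
    ext r s
    simp [hCdef, hc, mul_comm]
  have hinj : Function.Injective fun M : Matrix (Fin n ⊕ Fin n) (Fin n ⊕ Fin n) k =>
      M.map (algebraMap k K) := Matrix.map_injective (algebraMap k K).injective
  have hC : C * C = 1 := by
    apply hinj
    rw [hAC, smul_mul_smul_comm, ← pow_two, hi, neg_one_smul, neg_inj] at h2
    simpa [Matrix.map_mul] using h2
  have hCJC : Cᵀ * SpJ n k * C = -SpJ n k := by
    apply hinj
    rw [IsSymp, hAC, transpose_smul, smul_mul_assoc, smul_mul_smul_comm, ← pow_two, hi,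
      neg_one_smul] at hA
    have hneg := Matrix.map_neg (algebraMap k K) (map_neg (algebraMap k K)) (SpJ n k)
    simp only [Matrix.map_mul, hneg, SpJ_map]
    exact neg_eq_iff_eq_neg.mp hA
  have hJ : SpJ n k * C = -(Cᵀ * SpJ n k) := by
    rw [← mul_one (Cᵀ * SpJ n k), ← hC, ← mul_assoc, hCJC, neg_mul, neg_neg]
  obtain ⟨X, hX, hXsymp, hCX⟩ := exists_isSymp_diagonalizing hchar C hC hJ
  refine ⟨X, hX, ?_, 1, ?_⟩
  · have hXK : IsUnit (X.map (algebraMap k K)).det :=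
      (Matrix.isUnit_iff_isUnit_det _).mp (hX.map (algebraMap k K).mapMatrix)
    have hD : fromBlocks (i • (1 : Matrix (Fin n) (Fin n) K)) 0 0
        (-i • (1 : Matrix (Fin n) (Fin n) K)) =
        i • (fromBlocks 1 0 0 (-1) : Matrix (Fin n ⊕ Fin n) (Fin n ⊕ Fin n) k).map
          (algebraMap k K) := by
      rw [fromBlocks_map, Matrix.map_neg _ (map_neg (algebraMap k K)), fromBlocks_smul]
      simp
    rw [hD, mul_smul_comm, ← Matrix.map_mul, ← hCX, Matrix.map_mul, smul_mul_assoc,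
      Matrix.mul_nonsing_inv_cancel_right _ _ hXK, hAC]
  · rw [hXsymp, SpJ]
    simp
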